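/- Let Γ be the subgroup of SL₂(ℤ[ω]) generated by A = [[1,1],[0,1]] and B = [[1,0],[-ω,1]]. If ξ and η are relatively prime Eisenstein integers, then there exist W ∈ Γ and a unit u ∈ {±1, ±ω, ±ω²} such that W·(1,0) = (u·ξ, u·η). -/

import Mathlib

noncomputable def ω : ℂ := -1/2 + (Real.sqrt 3 / 2) * Complex.I

noncomputable def Eisenstein : Subring ℂ := Subring.closure {ω}

theorem omega_re : ω.re = -1 / 2 := by
  simp [ω]

theorem omega_im : ω.im = Real.sqrt 3 / 2 := by
  simp [ω]

theorem omega_sq : ω ^ 2 = -1 - ω := by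
  have h3 : Real.sqrt 3 * Real.sqrt 3 = 3 := Real.mul_self_sqrt (by norm_num)
  apply Complex.ext
  · simp only [pow_two, Complex.mul_re, Complex.sub_re, Complex.neg_re, Complex.one_re,
      omega_re, omega_im]
    nlinarith
  · simp only [pow_two, Complex.mul_im, Complex.sub_im, Complex.neg_im, Complex.one_im,
      omega_re, omega_im]
    ring

theorem omega_pow_six : ω ^ 6 = 1 := by
  linear_combination (ω ^ 4 - ω ^ 3 + ω - 1) * omega_sq

theorem omega_mem : ω ∈ Eisenstein := Subring.subset_closure rfl

theorem mem_eisenstein_iff {z : ℂ} : z ∈ Eisenstein ↔ ∃ m n : ℤ, z = m + n * ω := by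
  constructor
  · intro hz
    induction hz using Subring.closure_induction with
    | mem x hx => exact ⟨0, 1, by simpa using hx⟩
    | zero => exact ⟨0, 0, by simp⟩
    | one => exact ⟨1, 0, by simp⟩
    | add x y _ _ hx hy =>
      obtain ⟨a, b, rfl⟩ := hx
      obtain ⟨c, d, rfl⟩ := hy
      exact ⟨a + c, b + d, by push_cast; ring⟩
    | neg x _ hx =>
      obtain ⟨a, b, rfl⟩ := hx
      exact ⟨-a, -b, by push_cast; ring⟩
    | mul x y _ _ hx hy =>
      obtain ⟨a, b, rfl⟩ := hx
      obtain ⟨c, d, rfl⟩ := hy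
      exact ⟨a * c - b * d, a * d + b * c - b * d, by
        push_cast; linear_combination (b * d : ℂ) * omega_sq⟩
  · rintro ⟨m, n, rfl⟩
    exact add_mem (intCast_mem _ m) (mul_mem (intCast_mem _ n) omega_mem)

theorem normSq_int_add_int_mul_omega (m n : ℤ) :
    Complex.normSq (m + n * ω) = ((m ^ 2 - m * n + n ^ 2 : ℤ) : ℝ) := by
  have h3 : Real.sqrt 3 * Real.sqrt 3 = 3 := Real.mul_self_sqrt (by norm_num)
  simp only [Complex.normSq_apply, Complex.add_re, Complex.add_im, Complex.mul_re, Complex.mul_im,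
    Complex.intCast_re, Complex.intCast_im, omega_re, omega_im]
  push_cast
  linear_combination (n ^ 2 / 4 : ℝ) * h3

theorem exists_eisenstein_normSq_sub_lt_one (z : ℂ) :
    ∃ q : Eisenstein, Complex.normSq (z - q) < 1 := by
  have h3 : Real.sqrt 3 * Real.sqrt 3 = 3 := Real.mul_self_sqrt (by norm_num)
  have hs : 0 < Real.sqrt 3 := Real.sqrt_pos.2 (by norm_num)
  set t : ℝ := z.im / (Real.sqrt 3 / 2) with ht
  have htz : z.im = t * (Real.sqrt 3 / 2) := by rw [ht]; field_simp
  set n : ℤ := round t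
  set m : ℤ := round (z.re + n / 2)
  refine ⟨⟨m + n * ω, mem_eisenstein_iff.2 ⟨m, n, rfl⟩⟩, ?_⟩
  have hn := abs_le.1 (abs_sub_round t)
  have hm := abs_le.1 (abs_sub_round (z.re + n / 2))
  change _ ≤ t - (n : ℝ) ∧ t - (n : ℝ) ≤ _ at hn
  change _ ≤ z.re + n / 2 - (m : ℝ) ∧ z.re + n / 2 - (m : ℝ) ≤ _ at hm
  simp only [Complex.normSq_apply, Complex.add_re, Complex.add_im, Complex.mul_re, Complex.mul_im,
    Complex.intCast_re, Complex.intCast_im, Complex.sub_re, Complex.sub_im, omega_re, omega_im, htz]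
  have key : (z.re + n / 2 - m) * (z.re + n / 2 - m) + 3 / 4 * ((t - n) * (t - n)) < 1 := by
    nlinarith
  linear_combination key + (t - n) ^ 2 / 4 * h3

theorem one_le_normSq_of_ne_zero {a : Eisenstein} (ha : a ≠ 0) :
    1 ≤ Complex.normSq (a : ℂ) := by
  obtain ⟨m, n, h⟩ := mem_eisenstein_iff.1 a.2
  have hpos : 0 < Complex.normSq (a : ℂ) :=
    Complex.normSq_pos.2 fun h0 => ha (Subtype.ext h0)
  rw [h, normSq_int_add_int_mul_omega] at hpos ⊢
  exact_mod_cast hpos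

theorem exists_nat_normSq_eq (a : Eisenstein) : ∃ k : ℕ, Complex.normSq (a : ℂ) = k := by
  obtain ⟨m, n, h⟩ := mem_eisenstein_iff.1 a.2
  have h0 := Complex.normSq_nonneg (a : ℂ)
  rw [h, normSq_int_add_int_mul_omega] at h0 ⊢
  lift m ^ 2 - m * n + n ^ 2 to ℕ using (by exact_mod_cast h0) with k
  exact ⟨k, by simp⟩

theorem pow_six_eq_one_of_mul_eq_one {a b : Eisenstein} (hab : a * b = 1) :
    (a : ℂ) ^ 6 = 1 := by
  have ha : a ≠ 0 := left_ne_zero_of_mul_eq_one hab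
  have hb : b ≠ 0 := right_ne_zero_of_mul_eq_one hab
  have h : Complex.normSq (a : ℂ) * Complex.normSq (b : ℂ) = 1 := by
    rw [← map_mul, ← Subring.coe_mul, hab]; simp
  have h1 : Complex.normSq (a : ℂ) = 1 := by
    nlinarith [one_le_normSq_of_ne_zero ha, one_le_normSq_of_ne_zero hb]
  obtain ⟨m, n, hmn⟩ := mem_eisenstein_iff.1 a.2
  rw [hmn, normSq_int_add_int_mul_omega] at h1
  have h2 : m ^ 2 - m * n + n ^ 2 = 1 := by exact_mod_cast h1
  have hm : -1 ≤ m ∧ m ≤ 1 := by constructor <;> nlinarith [sq_nonneg (2 * n - m)]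
  have hn : -1 ≤ n ∧ n ≤ 1 := by constructor <;> nlinarith [sq_nonneg (2 * m - n)]
  obtain ⟨hm1, hm2⟩ := hm
  obtain ⟨hn1, hn2⟩ := hn
  have h6 := omega_pow_six
  have hc : (1 + ω) ^ 6 = 1 := by
    rw [show 1 + ω = -ω ^ 2 by rw [omega_sq]; ring]
    linear_combination (ω ^ 6 + 1) * h6
  rw [hmn]
  interval_cases m <;> interval_cases n <;> first
    | (exfalso; norm_num at h2; done)
    | (push_cast; norm_num; done)
    | (push_cast; linear_combination h6)
    | (push_cast; linear_combination hc)

theorem mem_units_of_pow_six_eq_one {u : ℂ} (hu : u ^ 6 = 1) :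
    u ∈ ({1, -1, ω, -ω, ω ^ 2, -ω ^ 2} : Set ℂ) := by
  have h : (u - 1) * (u + 1) * (u - ω) * (u + ω) * (u - ω ^ 2) * (u + ω ^ 2) = 0 := by
    have e : (u - 1) * (u + 1) * (u - ω) * (u + ω) * (u - ω ^ 2) * (u + ω ^ 2)
        = (u ^ 2 - 1) * (u ^ 4 - (ω ^ 2 + ω ^ 4) * u ^ 2 + ω ^ 6) := by ring
    have e4 : ω ^ 2 + ω ^ 4 = -1 := by
      linear_combination (ω ^ 2 - ω + 1) * omega_sq
    rw [e, e4, omega_pow_six]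
    linear_combination hu
  simp only [mul_eq_zero, sub_eq_zero, add_eq_zero_iff_eq_neg] at h
  simp only [Set.mem_insert_iff, Set.mem_singleton_iff]
  tauto

theorem mem_eisenstein_of_pow_six_eq_one {u : ℂ} (hu : u ^ 6 = 1) : u ∈ Eisenstein := by
  have h := mem_units_of_pow_six_eq_one hu
  have hω := omega_mem
  simp only [Set.mem_insert_iff, Set.mem_singleton_iff] at h
  rcases h with rfl | rfl | rfl | rfl | rfl | rfl <;>
    simp only [neg_mem_iff, one_mem, hω, pow_mem]

/-- The Eisenstein integers are a Euclidean domain with respect to the norm. -/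
noncomputable abbrev eisensteinEuclideanDomain : EuclideanDomain Eisenstein :=
  { (inferInstance : CommRing Eisenstein), (inferInstance : Nontrivial Eisenstein) with
    quotient := fun a b =>
      if b = 0 then 0 else (exists_eisenstein_normSq_sub_lt_one ((a : ℂ) / b)).choose
    quotient_zero := fun a => by simp
    remainder := fun a b => a - b *
      (if b = 0 then 0 else (exists_eisenstein_normSq_sub_lt_one ((a : ℂ) / b)).choose)
    quotient_mul_add_remainder_eq := fun a b => by ring
    r := fun a b => ⌊Complex.normSq (a : ℂ)⌋₊ < ⌊Complex.normSq (b : ℂ)⌋₊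
    r_wellFounded := (measure fun a : Eisenstein => ⌊Complex.normSq (a : ℂ)⌋₊).wf
    remainder_lt := fun a b hb => by
      simp only [if_neg hb]
      generalize hq : (exists_eisenstein_normSq_sub_lt_one ((a : ℂ) / b)).choose = q
      have hlt : Complex.normSq ((a : ℂ) / b - q) < 1 :=
        hq ▸ (exists_eisenstein_normSq_sub_lt_one ((a : ℂ) / b)).choose_spec
      have hb' : (b : ℂ) ≠ 0 := fun h => hb (Subtype.ext h)
      have e : ((a - b * q : Eisenstein) : ℂ) = b * ((a : ℂ) / b - q) := by
        push_cast; field_simp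
      have hn : Complex.normSq ((a - b * q : Eisenstein) : ℂ) < Complex.normSq (b : ℂ) := by
        rw [e, map_mul]
        exact mul_lt_of_lt_one_right (Complex.normSq_pos.2 hb') hlt
      obtain ⟨k, hk⟩ := exists_nat_normSq_eq (a - b * q)
      obtain ⟨l, hl⟩ := exists_nat_normSq_eq b
      rw [hk, hl] at hn ⊢
      simpa using hn
    mul_left_not_lt := fun a b hb => by
      rw [not_lt]
      apply Nat.floor_le_floor
      rw [Subring.coe_mul, map_mul]
      exact le_mul_of_one_le_right (Complex.normSq_nonneg _) (one_le_normSq_of_ne_zero hb) }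

theorem isCoprime_of_forall_dvd_isUnit {ξ η : Eisenstein}
    (h : ∀ δ : Eisenstein, δ ∣ ξ → δ ∣ η → IsUnit δ) : IsCoprime ξ η := by
  let _ := eisensteinEuclideanDomain
  have : IsRelPrime ξ η := fun δ h1 h2 => h δ h1 h2
  exact this.isCoprime

/-- A relation on `ℂ²` stable under the two generators and under scaling by units, and containing
`(1, 0)`, contains every `(b, 1)` with `b` an Eisenstein integer. -/
theorem eisenstein_one_of_invariant (O : ℂ → ℂ → Prop) (h1 : O 1 0)
    (hA : ∀ x y, O x y ↔ O (x + y) y) (hB : ∀ x y, O x y ↔ O x (y - ω * x))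
    (hu : ∀ u x y, u ^ 6 = 1 → (O x y ↔ O (u * x) (u * y))) (b : Eisenstein) :
    O b 1 := by
  have hAn : ∀ x y, O x y ↔ O (x - y) y := fun x y => by
    rw [hA (x - y) y, sub_add_cancel]
  have hBn : ∀ x y, O x y ↔ O x (y + ω * x) := fun x y => by
    rw [hB x (y + ω * x), add_sub_cancel_right]
  have hω := omega_sq
  have hL : ∀ x y, O x y ↔ O (x - 4 * ω * y) y := fun x y => by
    refine ((hA x y).trans <| (hA _ _).trans <| (hBn _ _).trans <| (hA _ _).trans <|
      (hB _ _).trans <| (hAn _ _).trans <| (hAn _ _).trans <| (hB _ _).trans <|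
      (hA _ _).trans <| (hBn _ _)).trans <|
      (iff_of_eq (congrArg₂ O ?_ ?_)).trans (hu (-1) _ _ (by norm_num)).symm
    · grind
    · grind
  have hAz : ∀ (m : ℤ) (x : ℂ), O x 1 ↔ O (x + m) 1 := fun m x => by
    induction m with
    | zero => simp
    | succ k ih => rw [ih, hA]; push_cast; rw [add_assoc]
    | pred k ih => rw [ih, hAn]; push_cast; rw [add_sub_assoc]
  have hLz : ∀ (m : ℤ) (x : ℂ), O x 1 ↔ O (x - m * (4 * ω)) 1 := fun m x => by
    induction m with
    | zero => simp
    | succ k ih => rw [ih, hL]; push_cast; ring_nf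
    | pred k ih => rw [ih, hL (x - (((-k - 1 : ℤ) : ℂ)) * (4 * ω))]; push_cast; ring_nf
  have hω3 : ω ^ 3 = 1 := by grind
  have b1 : O (1 + ω) 1 := by
    have h := (hu (-ω ^ 2) _ _ (by grind)).1 ((hB 1 0).1 h1)
    convert h using 1 <;> grind
  have b3 : O (-1 - ω) 1 := by
    have h := (hu (ω ^ 2) _ _ (by grind)).1 ((hBn 1 0).1 h1)
    convert h using 1 <;> grind
  have b0 : O (-1) 1 := by
    have h := (hu ω _ _ omega_pow_six).1 ((hBn _ _).1 ((hAn _ _).1 ((hB 1 0).1 h1)))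
    convert h using 1 <;> grind
  have b2 : O (1 + 2 * ω) 1 := by
    have h := (hu ω _ _ omega_pow_six).1 ((hB _ _).1 ((hAn _ _).1 ((hBn 1 0).1 h1)))
    convert h using 1 <;> grind
  obtain ⟨m, n, hb⟩ := mem_eisenstein_iff.1 b.2
  have hr : O (((n % 4 : ℤ) : ℂ) * ω) 1 := by
    have h0 := Int.emod_nonneg n (by norm_num : (4 : ℤ) ≠ 0)
    have h4 := Int.emod_lt_of_pos n (by norm_num : (0 : ℤ) < 4)
    generalize n % 4 = k at h0 h4
    interval_cases k
    · convert (hAz 1 _).1 b0 using 1; push_cast; ring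
    · convert (hAz (-1) _).1 b1 using 1; push_cast; ring
    · convert (hAz (-1) _).1 b2 using 1; push_cast; ring
    · convert (hAz 1 _).1 ((hLz (-1) _).1 b3) using 1; push_cast; ring
  have hn : (n : ℂ) = (n % 4 : ℤ) + 4 * (n / 4 : ℤ) := by
    exact_mod_cast (Int.emod_add_mul_ediv n 4).symm
  rw [hb]
  convert (hAz m _).1 ((hLz (-(n / 4)) _).1 hr) using 1
  rw [hn]; push_cast; ring

/-- Matrices in the group generated by `A` and `B` have Eisenstein integer entries. -/
theorem entries_mem_eisenstein (A B : Matrix.SpecialLinearGroup (Fin 2) ℂ)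
    (hA : (A : Matrix (Fin 2) (Fin 2) ℂ) = !![1, 1; 0, 1])
    (hB : (B : Matrix (Fin 2) (Fin 2) ℂ) = !![1, 0; -ω, 1])
    {W : Matrix.SpecialLinearGroup (Fin 2) ℂ}
    (hW : W ∈ Subgroup.closure ({A, B} : Set (Matrix.SpecialLinearGroup (Fin 2) ℂ))) :
    ∀ i j, (W : Matrix (Fin 2) (Fin 2) ℂ) i j ∈ Eisenstein := by
  have hω := omega_mem
  induction hW using Subgroup.closure_induction with
  | mem x hx =>
    rcases hx with rfl | rfl
    · rw [hA]; intro i j; fin_cases i <;> fin_cases j <;> simp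
    · rw [hB]; intro i j; fin_cases i <;> fin_cases j <;> simp [hω]
  | one => intro i j; fin_cases i <;> fin_cases j <;> simp
  | mul x y _ _ hx hy =>
    intro i j
    rw [Matrix.SpecialLinearGroup.coe_mul, Matrix.mul_apply]
    exact sum_mem fun k _ => mul_mem (hx i k) (hy k j)
  | inv x _ hx =>
    rw [Matrix.SpecialLinearGroup.coe_inv, Matrix.adjugate_fin_two]
    intro i j
    fin_cases i <;> fin_cases j <;> simp [hx]

/-- `(x, y)` is, up to a unit of the Eisenstein integers, in the `Γ`-orbit of `(1, 0)`. -/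
def InUnitOrbit (Γ : Subgroup (Matrix.SpecialLinearGroup (Fin 2) ℂ)) (x y : ℂ) : Prop :=
  ∃ W ∈ Γ, ∃ u : ℂ, u ^ 6 = 1 ∧
    (W : Matrix (Fin 2) (Fin 2) ℂ) 0 0 = u * x ∧ (W : Matrix (Fin 2) (Fin 2) ℂ) 1 0 = u * y

namespace InUnitOrbit

variable {Γ : Subgroup (Matrix.SpecialLinearGroup (Fin 2) ℂ)}

theorem one_zero : InUnitOrbit Γ 1 0 := ⟨1, one_mem _, 1, by simp, by simp, by simp⟩

theorem smul {x y : ℂ} (h : InUnitOrbit Γ x y) {V : Matrix.SpecialLinearGroup (Fin 2) ℂ}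
    (hV : V ∈ Γ) :
    InUnitOrbit Γ ((V : Matrix (Fin 2) (Fin 2) ℂ) 0 0 * x + (V : Matrix (Fin 2) (Fin 2) ℂ) 0 1 * y)
      ((V : Matrix (Fin 2) (Fin 2) ℂ) 1 0 * x + (V : Matrix (Fin 2) (Fin 2) ℂ) 1 1 * y) := by
  obtain ⟨W, hW, u, hu, h0, h1⟩ := h
  refine ⟨V * W, mul_mem hV hW, u, hu, ?_, ?_⟩ <;>
  · rw [Matrix.SpecialLinearGroup.coe_mul, Matrix.mul_apply, Fin.sum_univ_two, h0, h1]
    ring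

theorem of_unit_mul {v x y : ℂ} (hv : v ^ 6 = 1) (h : InUnitOrbit Γ (v * x) (v * y)) :
    InUnitOrbit Γ x y := by
  obtain ⟨W, hW, u, hu, h0, h1⟩ := h
  exact ⟨W, hW, u * v, by rw [mul_pow, hu, hv, one_mul], by rw [h0, mul_assoc],
    by rw [h1, mul_assoc]⟩

theorem unit_mul_iff {v x y : ℂ} (hv : v ^ 6 = 1) :
    InUnitOrbit Γ x y ↔ InUnitOrbit Γ (v * x) (v * y) := by
  refine ⟨fun h => ?_, of_unit_mul hv⟩
  have e : ∀ z : ℂ, v ^ 5 * (v * z) = z := fun z => by linear_combination z * hv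
  refine of_unit_mul (v := v ^ 5) (by rw [← pow_mul, mul_comm, pow_mul, hv, one_pow]) ?_
  rwa [e, e]

end InUnitOrbit

theorem inUnitOrbit_eisenstein_one (A B : Matrix.SpecialLinearGroup (Fin 2) ℂ)
    (hA : (A : Matrix (Fin 2) (Fin 2) ℂ) = !![1, 1; 0, 1])
    (hB : (B : Matrix (Fin 2) (Fin 2) ℂ) = !![1, 0; -ω, 1]) (b : Eisenstein) :
    InUnitOrbit (Subgroup.closure {A, B}) b 1 := by
  have hAm : A ∈ Subgroup.closure {A, B} := Subgroup.subset_closure (by simp)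
  have hBm : B ∈ Subgroup.closure {A, B} := Subgroup.subset_closure (by simp)
  refine eisenstein_one_of_invariant _ .one_zero (fun x y => ⟨fun h => ?_, fun h => ?_⟩)
    (fun x y => ⟨fun h => ?_, fun h => ?_⟩) (fun u x y => InUnitOrbit.unit_mul_iff) b
  · simpa [hA] using h.smul hAm
  · have := h.smul (inv_mem hAm)
    rw [Matrix.SpecialLinearGroup.coe_inv, Matrix.adjugate_fin_two] at this
    simpa [hA] using this
  · have := h.smul hBm
    simp only [hB] at this
    convert this using 1
    · simp
    · simp; ring
  · have := h.smul (inv_mem hBm)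
    rw [Matrix.SpecialLinearGroup.coe_inv, Matrix.adjugate_fin_two] at this
    simpa [hB] using this

/-- The first column of an Eisenstein integer matrix of determinant `±1` is in the orbit of `(1, 0)`
up to a unit. The proof is Euclid's algorithm on the second row. -/
theorem inUnitOrbit_of_det_mul_self_eq_one (A B : Matrix.SpecialLinearGroup (Fin 2) ℂ)
    (hA : (A : Matrix (Fin 2) (Fin 2) ℂ) = !![1, 1; 0, 1])
    (hB : (B : Matrix (Fin 2) (Fin 2) ℂ) = !![1, 0; -ω, 1]) (c d : Eisenstein) :
    ∀ a b e : Eisenstein, e * e = 1 → a * d - b * c = e →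
      InUnitOrbit (Subgroup.closure {A, B}) a c := by
  let _ := eisensteinEuclideanDomain
  induction c, d using EuclideanDomain.GCD.induction with
  | H0 d =>
    intro a b e he h
    have ha : (a : ℂ) ^ 6 = 1 :=
      pow_six_eq_one_of_mul_eq_one (b := d * e) (by linear_combination e * h + he)
    simpa using (InUnitOrbit.unit_mul_iff ha).1 (InUnitOrbit.one_zero (Γ := .closure {A, B}))
  | H1 c d hc ih =>
    intro a b e he h
    have hdiv := EuclideanDomain.div_add_mod d c
    generalize d / c = q at hdiv
    generalize d % c = r at hdiv ih
    obtain ⟨W, hW, u, hu, h0, h1⟩ :=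
      ih (b - a * q) a (-e) (by rw [neg_mul_neg, he]) (by linear_combination -h - a * hdiv)
    have hent := entries_mem_eisenstein A B hA hB hW
    have hdet := W.det_coe
    rw [Matrix.det_fin_two] at hdet
    have he6 : (e : ℂ) ^ 6 = 1 := pow_six_eq_one_of_mul_eq_one he
    have hv : (-u * e) ^ 6 = 1 := by
      rw [mul_pow, he6, neg_pow, hu]; norm_num
    have hv' := mem_eisenstein_of_pow_six_eq_one hv
    have hcol : (-u * e : ℂ) = W.1 0 0 * c - W.1 1 0 * a := by
      have hC : (a * d - b * c : ℂ) = e := by exact_mod_cast congrArg Subtype.val h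
      have hD : (c * q + r : ℂ) = d := by exact_mod_cast congrArg Subtype.val hdiv
      rw [h0, h1]
      push_cast
      linear_combination u * hC + u * a * hD
    generalize (-u * e : ℂ) = v at hv hv' hcol
    have hp := mul_mem (pow_mem hv' 5) (sub_mem (mul_mem (hent 1 1) a.2) (mul_mem (hent 0 1) c.2))
    have h2 := (InUnitOrbit.unit_mul_iff hv).1 (inUnitOrbit_eisenstein_one A B hA hB ⟨_, hp⟩)
    convert h2.smul hW using 1
    · linear_combination (-a : ℂ) * hdet - W.1 0 0 * (W.1 1 1 * a - W.1 0 1 * c) * hv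
        - W.1 0 1 * hcol
    · linear_combination (-c : ℂ) * hdet - W.1 1 0 * (W.1 1 1 * a - W.1 0 1 * c) * hv
        - W.1 1 1 * hcol

theorem coprime_in_orbit (A B : Matrix.SpecialLinearGroup (Fin 2) ℂ)
    (hA : (A : Matrix (Fin 2) (Fin 2) ℂ) = !![1, 1; 0, 1])
    (hB : (B : Matrix (Fin 2) (Fin 2) ℂ) = !![1, 0; -ω, 1])
    (ξ η : Eisenstein)
    (hcop : ∀ δ : Eisenstein, δ ∣ ξ → δ ∣ η → IsUnit δ) :
    ∃ W ∈ Subgroup.closure ({A, B} : Set (Matrix.SpecialLinearGroup (Fin 2) ℂ)),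
      ∃ u : ℂ, u ∈ ({1, -1, ω, -ω, ω ^ 2, -ω ^ 2} : Set ℂ) ∧
        ((W : Matrix (Fin 2) (Fin 2) ℂ)).mulVec ![1, 0] = ![u * ξ, u * η] := by
  obtain ⟨s, t, hst⟩ := isCoprime_of_forall_dvd_isUnit hcop
  obtain ⟨W, hW, u, hu, h0, h1⟩ :=
    inUnitOrbit_of_det_mul_self_eq_one A B hA hB η s ξ (-t) 1 (one_mul 1) (by linear_combination hst)
  refine ⟨W, hW, u, mem_units_of_pow_six_eq_one hu, ?_⟩
  ext i
  fin_cases i <;> simp [Matrix.mulVec, dotProduct, h0, h1]
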